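/- arXiv:2311.03398 — 3 statements merged into one kernel-verified Lean document; each statement's English description precedes it below -/
import Mathlib

section
/- Let n ≥ 1 and let b₀, b₁, …, bₙ be integers. Fix k with 1 ≤ k ≤ n, and let c₀, c₁, …, cₙ be the sequence obtained from b₀, …, bₙ by swapping the 0th term and the kth term (i.e., c₀ = b_k, c_k = b₀, и c_i = b_i for all other i). Then the number of sign choices ε : {1,…,n} → {−1,1} satisfying ε₁b₁ + ε₂b₂ + ⋯ + εₙbₙ = b₀ equals the number of sign choices ε : {1,…,n} → {−1,1} satisfying ε₁c₁ + ε₂c₂ + ⋯ + εₙcₙ = c₀. -/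
/-- For a sequence `b 0, b 1, …, b n` of integers, swapping the 0th term with the
`k`th term (`1 ≤ k ≤ n`) does not change the number of sign choices
`ε : {1,…,n} → {−1,1}` with `ε 1 * b 1 + ⋯ + ε n * b n = b 0`. -/
theorem stmt_0 (n : ℕ) (hn : 1 ≤ n) (b : ℕ → ℤ) (k : ℕ) (hk1 : 1 ≤ k) (hkn : k ≤ n)
    (c : ℕ → ℤ) (hc0 : c 0 = b k) (hck : c k = b 0)
    (hc : ∀ i, i ≠ 0 → i ≠ k → c i = b i) :
    (Finset.univ.filter fun ε : Fin n → ℤˣ =>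
        ∑ i : Fin n, (ε i : ℤ) * b ((i : ℕ) + 1) = b 0).card =
    (Finset.univ.filter fun ε : Fin n → ℤˣ =>
        ∑ i : Fin n, (ε i : ℤ) * c ((i : ℕ) + 1) = c 0).card := by
  obtain ⟨m, rfl⟩ : ∃ m, k = m + 1 := ⟨k - 1, by omega⟩
  let j : Fin n := ⟨m, by omega⟩
  let f : (Fin n → ℤˣ) → (Fin n → ℤˣ) := fun ε i => if i = j then ε j else -(ε j * ε i)
  have hf : Function.Involutive f := by
    intro ε
    funext i
    by_cases h : i = j
    · simp [f, h]
    · simp [f, h, ← mul_assoc]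
  refine Finset.card_bijective f hf.bijective ?_
  intro ε
  simp only [Finset.mem_filter, Finset.mem_univ, true_and]
  rw [← Finset.add_sum_erase _ _ (Finset.mem_univ j),
    ← Finset.add_sum_erase (a := j) _ (fun i : Fin n => (f ε i : ℤ) * c ((i : ℕ) + 1))
      (Finset.mem_univ j)]
  have hs : ∑ i ∈ Finset.univ.erase j, (f ε i : ℤ) * c ((i : ℕ) + 1) =
      -((ε j : ℤ) * ∑ i ∈ Finset.univ.erase j, (ε i : ℤ) * b ((i : ℕ) + 1)) := by
    rw [Finset.mul_sum, ← Finset.sum_neg_distrib]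
    refine Finset.sum_congr rfl fun i hi => ?_
    have hij : i ≠ j := Finset.ne_of_mem_erase hi
    have hv : (i : ℕ) ≠ m := fun h => hij (Fin.ext h)
    rw [hc _ (by omega) (by omega)]
    simp [f, hij, mul_assoc]
  have hj : f ε j = ε j := by simp [f]
  have hjm : (j : ℕ) = m := rfl
  rw [hs, hj, hjm, hck, hc0]
  generalize ∑ i ∈ Finset.univ.erase j, (ε i : ℤ) * b ((i : ℕ) + 1) = S
  rcases Int.units_eq_one_or (ε j) with h | h
  · rw [h]; simp only [Units.val_one, one_mul]; constructor <;> intro h <;> linarith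
  · rw [h]; simp only [Units.val_neg, Units.val_one]; constructor <;> intro h <;> linarith
end

section
/- Let n ≥ 0 and let b₀, b₁, …, bₙ be integers. Then ∫₀^π Σ_{ε ∈ {−1,1}^n} cos((−b₀ + ε₁b₁ + ε₂b₂ + ⋯ + εₙbₙ)·x) dx = T(X_n)·π, where the sum runs over all 2^n sign vectors ε = (ε₁,…,εₙ) ∈ {−1,1}^n. -/
theorem integral_cos_int_mul (k : ℤ) :
    ∫ x in (0:ℝ)..Real.pi, Real.cos ((k : ℝ) * x) = if k = 0 then Real.pi else 0 := by
  split_ifs with h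
  · simp [h]
  · have hk : (k : ℝ) ≠ 0 := by exact_mod_cast h
    rw [intervalIntegral.integral_comp_mul_left (fun x => Real.cos x) hk, integral_cos]
    simp [Real.sin_int_mul_pi]


/-- `∫₀^π Σ_{ε ∈ {−1,1}^n} cos((−b₀ + ε₁b₁ + ⋯ + εₙbₙ)·x) dx = T(Xₙ)·π`, where
`T(Xₙ)` is the number of sign choices `ε` with `ε₁b₁ + ⋯ + εₙbₙ = b₀`. -/
theorem stmt_1 (n : ℕ) (b : ℕ → ℤ) :
    ∫ x in (0:ℝ)..Real.pi,
        ∑ ε : Fin n → ℤˣ,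
          Real.cos (((-b 0 + ∑ i : Fin n, (ε i : ℤ) * b ((i : ℕ) + 1) : ℤ) : ℝ) * x) =
    ((Finset.univ.filter fun ε : Fin n → ℤˣ =>
        ∑ i : Fin n, (ε i : ℤ) * b ((i : ℕ) + 1) = b 0).card : ℝ) * Real.pi := by
  rw [intervalIntegral.integral_finset_sum]
  · rw [Finset.sum_congr rfl fun ε _ => integral_cos_int_mul _, ← Finset.sum_filter,
      Finset.sum_const, nsmul_eq_mul]
    congr 3
    ext ε
    simp only [Finset.mem_filter, Finset.mem_univ, true_and]
    omega
  · intro ε _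
    exact Continuous.intervalIntegrable (by fun_prop) _ _
end

section
/- Let n ≥ 0, let b₀, b₁, …, bₙ be integers, and let p, q be arbitrary integers. Then ∫_{−qπ}^{pπ} Σ_{ε ∈ {−1,1}^n} cos((−b₀ + ε₁b₁ + ε₂b₂ + ⋯ + εₙbₙ)·x) dx = (p+q)·T(X_n)·π, where the sum runs over all 2^n sign vectors ε = (ε₁,…,εₙ) ∈ {−1,1}^n. -/
theorem integral_cos_int_aux (m p q : ℤ) :
    (∫ x in (-(q : ℝ) * Real.pi)..((p : ℝ) * Real.pi), Real.cos ((m : ℝ) * x)) =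
      if m = 0 then ((p + q : ℤ) : ℝ) * Real.pi else 0 := by
  split_ifs with h
  · subst h
    simp
    ring
  · have hm : (m : ℝ) ≠ 0 := by exact_mod_cast h
    rw [intervalIntegral.integral_comp_mul_left (fun x => Real.cos x) hm, integral_cos]
    have h1 : (m : ℝ) * ((p : ℝ) * Real.pi) = ((m * p : ℤ) : ℝ) * Real.pi := by
      push_cast; ring
    have h2 : (m : ℝ) * (-(q : ℝ) * Real.pi) = ((m * -q : ℤ) : ℝ) * Real.pi := by
      push_cast; ring
    rw [h1, h2, Real.sin_int_mul_pi, Real.sin_int_mul_pi]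
    simp

/-- For arbitrary integers `p, q`,
`∫_{−qπ}^{pπ} Σ_{ε ∈ {−1,1}^n} cos((−b₀ + ε₁b₁ + ⋯ + εₙbₙ)·x) dx = (p+q)·T(Xₙ)·π`,
where `T(Xₙ)` is the number of sign choices `ε` with `ε₁b₁ + ⋯ + εₙbₙ = b₀`. -/
theorem stmt_10 (n : ℕ) (b : ℕ → ℤ) (p q : ℤ) :
    ∫ x in (-(q : ℝ) * Real.pi)..((p : ℝ) * Real.pi),
        ∑ ε : Fin n → ℤˣ,
          Real.cos (((-b 0 + ∑ i : Fin n, (ε i : ℤ) * b ((i : ℕ) + 1) : ℤ) : ℝ) * x) =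
    ((p + q : ℤ) : ℝ) *
      ((Finset.univ.filter fun ε : Fin n → ℤˣ =>
          ∑ i : Fin n, (ε i : ℤ) * b ((i : ℕ) + 1) = b 0).card : ℝ) * Real.pi := by
  rw [intervalIntegral.integral_finsetSum]
  · simp only [integral_cos_int_aux]
    rw [← Finset.sum_filter, Finset.sum_const, nsmul_eq_mul]
    have : (Finset.univ.filter fun ε : Fin n → ℤˣ =>
        -b 0 + ∑ i : Fin n, (ε i : ℤ) * b ((i : ℕ) + 1) = 0) =
      (Finset.univ.filter fun ε : Fin n → ℤˣ =>
        ∑ i : Fin n, (ε i : ℤ) * b ((i : ℕ) + 1) = b 0) := by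
      apply Finset.filter_congr
      intro ε _
      constructor <;> intro h <;> linarith
    rw [this]
    ring
  · intro ε _
    apply Continuous.intervalIntegrable
    fun_prop
end
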